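/- (Unbiasedness of the QJL inner-product estimator.) For any positive integers m, d and any vectors q, k ∈ ℝ^d with k ≠ 0, the expectation over the random matrix S of Prod_QJL(q, k) equals ⟨q, k⟩, i.e. E_S[(√(π/2)/m) · ‖k‖₂ · ⟨S q, sign(S k)⟩] = ⟨q, k⟩. -/

import Mathlib

open MeasureTheory ProbabilityTheory Real

/-- Euclidean inner product on `ℝ^d`. -/
def iprod {d : ℕ} (u v : Fin d → ℝ) : ℝ := ∑ i, u i * v i

/-- Euclidean norm on `ℝ^d`. -/
noncomputable def nrm {d : ℕ} (u : Fin d → ℝ) : ℝ := Real.sqrt (∑ i, (u i) ^ 2)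

/-- Sign function: `1` if `x > 0` and `-1` if `x < 0` (the value at `0` is immaterial). -/
noncomputable def sgn (x : ℝ) : ℝ := if 0 < x then 1 else -1

/-- Measure on `m × d` real matrices (rows indexed by `Fin m`) with i.i.d. standard
Gaussian `N(0,1)` entries. -/
noncomputable def stdGaussianMat (m d : ℕ) : Measure (Fin m → Fin d → ℝ) :=
  Measure.pi fun _ => Measure.pi fun _ => gaussianReal 0 1

/-- The QJL inner-product estimator
`Prod_QJL(q,k) = (√(π/2)/m) · ‖k‖₂ · ⟨S q, sign(S k)⟩`, where `sign` is applied
entrywise to `S k`. -/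
noncomputable def prodQJL {m d : ℕ} (S : Fin m → Fin d → ℝ) (q k : Fin d → ℝ) : ℝ :=
  (Real.sqrt (Real.pi / 2) / m) * nrm k * ∑ i, iprod (S i) q * sgn (iprod (S i) k)

/-- The first absolute moment of a centred real Gaussian. -/
lemma integral_abs_gaussianReal_zero {v : NNReal} (hv : v ≠ 0) :
    ∫ x, |x| ∂(gaussianReal 0 v) = √v * √(2 / π) := by
  have hv' : (0 : ℝ) < v := by positivity
  have hhalf : ∫ x in Set.Ioi (0 : ℝ), x * exp (-x ^ 2 / (2 * v)) = v := by
    have h := integral_rpow_mul_exp_neg_mul_rpow (p := 2) (q := 1) (b := (2 * (v : ℝ))⁻¹)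
      (by norm_num) (by norm_num) (by positivity)
    norm_num [Real.Gamma_two, rpow_neg_one] at h
    calc ∫ x in Set.Ioi (0 : ℝ), x * exp (-x ^ 2 / (2 * v))
        = ∫ x in Set.Ioi (0 : ℝ), x * exp (-((v : ℝ)⁻¹ * (1 / 2) * x ^ 2)) := by
          congr! 4
          field_simp
      _ = v := by rw [h]; ring
  rw [integral_gaussianReal_eq_integral_smul hv]
  have hpdf : ∀ x : ℝ, gaussianPDFReal 0 v x • |x| =
      (fun y : ℝ => (√(2 * π * v))⁻¹ * (y * exp (-y ^ 2 / (2 * v)))) |x| := by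
    intro x
    simp only [gaussianPDFReal, smul_eq_mul, sub_zero, sq_abs]
    ring
  simp_rw [hpdf]
  rw [integral_comp_abs (f := fun y : ℝ => (√(2 * π * v))⁻¹ * (y * exp (-y ^ 2 / (2 * v)))),
    integral_const_mul, hhalf, sqrt_div (by norm_num), sqrt_mul (by positivity),
    sqrt_mul (by norm_num)]
  have h2 : √2 ^ 2 = (2 : ℝ) := sq_sqrt (by norm_num)
  have hvs : √(v : ℝ) ^ 2 = v := sq_sqrt hv'.le
  field_simp
  rw [h2, hvs]

lemma sgn_eq_one_or_neg_one (x : ℝ) : sgn x = 1 ∨ sgn x = -1 := by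
  unfold sgn
  split_ifs <;> simp

lemma mul_sgn_self (x : ℝ) : x * sgn x = |x| := by
  unfold sgn
  split_ifs with h
  · rw [abs_of_pos h, mul_one]
  · rw [abs_of_nonpos (not_lt.mp h), mul_neg_one]

lemma measurable_sgn : Measurable sgn :=
  Measurable.ite measurableSet_Ioi measurable_const measurable_const

/-- The linear functional `x ↦ ⟨x, u⟩` on `ℝ^d`. -/
noncomputable def iprodCLM {d : ℕ} (u : Fin d → ℝ) : (Fin d → ℝ) →L[ℝ] ℝ :=
  ∑ i, u i • ContinuousLinearMap.proj i

lemma iprodCLM_apply {d : ℕ} (u x : Fin d → ℝ) : iprodCLM u x = iprod x u := by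
  simp [iprodCLM, iprod, mul_comm]

/-- The standard Gaussian measure on `ℝ^d`, i.e. the law of one row of the sketching matrix. -/
noncomputable abbrev stdGaussianVec (d : ℕ) : Measure (Fin d → ℝ) :=
  Measure.pi fun _ => gaussianReal 0 1

lemma hasGaussianLaw_id_stdGaussianVec (d : ℕ) :
    HasGaussianLaw (fun x : Fin d → ℝ => x) (stdGaussianVec d) := by
  have hind : iIndepFun (fun (i : Fin d) (x : Fin d → ℝ) => x i) (stdGaussianVec d) :=
    iIndepFun_pi (X := fun _ x => x) fun _ => aemeasurable_id
  refine hind.hasGaussianLaw fun i => ?_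
  have h := (measurePreserving_eval (fun _ : Fin d => gaussianReal 0 1) i).map_eq
  exact ⟨by change IsGaussian ((stdGaussianVec d).map (Function.eval i)); rw [h]; infer_instance⟩

lemma hasGaussianLaw_iprod {d : ℕ} (u : Fin d → ℝ) :
    HasGaussianLaw (fun x => iprod x u) (stdGaussianVec d) := by
  simpa only [iprodCLM_apply] using (hasGaussianLaw_id_stdGaussianVec d).map_fun (iprodCLM u)

lemma hasGaussianLaw_iprod_prodMk {d : ℕ} (u v : Fin d → ℝ) :
    HasGaussianLaw (fun x => (iprod x u, iprod x v)) (stdGaussianVec d) := by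
  simpa only [ContinuousLinearMap.prod_apply, iprodCLM_apply] using
    (hasGaussianLaw_id_stdGaussianVec d).map_fun ((iprodCLM u).prod (iprodCLM v))

lemma memLp_eval_stdGaussianVec {d : ℕ} (i : Fin d) :
    MemLp (fun x : Fin d → ℝ => x i) 2 (stdGaussianVec d) :=
  ((hasGaussianLaw_id_stdGaussianVec d).eval i).memLp_two

lemma integral_iprod {d : ℕ} (u : Fin d → ℝ) : ∫ x, iprod x u ∂(stdGaussianVec d) = 0 := by
  unfold iprod
  rw [integral_finsetSum _ fun i _ =>
    ((memLp_eval_stdGaussianVec i).integrable one_le_two).mul_const _]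
  refine Finset.sum_eq_zero fun i _ => ?_
  rw [integral_mul_const, integral_eval, integral_id_gaussianReal, zero_mul]

lemma covariance_eval_stdGaussianVec {d : ℕ} (i j : Fin d) :
    cov[fun x => x i, fun x => x j; stdGaussianVec d] = if i = j then 1 else 0 := by
  split_ifs with h
  · subst h
    rw [covariance_self (measurable_pi_apply i).aemeasurable]
    have h := (measurePreserving_eval (fun _ : Fin d => gaussianReal 0 1) i).variance_fun_comp
      (f := id) aemeasurable_id
    simpa using h
  · have hind : iIndepFun (fun (i : Fin d) (x : Fin d → ℝ) => x i) (stdGaussianVec d) :=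
      iIndepFun_pi (X := fun _ x => x) fun _ => aemeasurable_id
    exact (hind.indepFun h).covariance_eq_zero (memLp_eval_stdGaussianVec i)
      (memLp_eval_stdGaussianVec j)

lemma covariance_iprod {d : ℕ} (u v : Fin d → ℝ) :
    cov[fun x => iprod x u, fun x => iprod x v; stdGaussianVec d] = iprod u v := by
  unfold iprod
  rw [covariance_fun_sum_fun_sum (fun i => (memLp_eval_stdGaussianVec i).mul_const _)
    fun i => (memLp_eval_stdGaussianVec i).mul_const _]
  simp [covariance_mul_const_left, covariance_mul_const_right, covariance_eval_stdGaussianVec]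

lemma iprod_self {d : ℕ} (u : Fin d → ℝ) : iprod u u = nrm u ^ 2 := by
  rw [nrm, sq_sqrt (Finset.sum_nonneg fun i _ => sq_nonneg _)]
  simp [iprod, sq]

lemma nrm_pos {d : ℕ} {u : Fin d → ℝ} (hu : u ≠ 0) : 0 < nrm u := by
  obtain ⟨i, hi⟩ := Function.ne_iff.mp hu
  exact sqrt_pos.mpr <| Finset.sum_pos' (fun i _ => sq_nonneg _)
    ⟨i, Finset.mem_univ i, sq_pos_of_ne_zero hi⟩

lemma integral_abs_iprod {d : ℕ} {u : Fin d → ℝ} (hu : u ≠ 0) :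
    ∫ x, |iprod x u| ∂(stdGaussianVec d) = nrm u * √(2 / π) := by
  have hn := nrm_pos hu
  have hlaw := hasGaussianLaw_iprod u
  have hmap := hlaw.map_eq_gaussianReal
  rw [integral_iprod, ← covariance_self hlaw.aemeasurable, covariance_iprod, iprod_self] at hmap
  rw [← integral_map (f := fun y : ℝ => |y|) hlaw.aemeasurable (by fun_prop), hmap,
    integral_abs_gaussianReal_zero (by simpa using hn.ne'), Real.coe_toNNReal _ (by positivity),
    sqrt_sq hn.le]

lemma integrable_iprod_mul_sgn {d : ℕ} (u v : Fin d → ℝ) :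
    Integrable (fun x => iprod x u * sgn (iprod x v)) (stdGaussianVec d) := by
  refine (hasGaussianLaw_iprod u).integrable.mul_bdd (c := 1)
    (measurable_sgn.comp_aemeasurable (hasGaussianLaw_iprod v).aemeasurable).aestronglyMeasurable
    (ae_of_all _ fun x => ?_)
  rcases sgn_eq_one_or_neg_one (iprod x v) with h | h <;> simp [h]

/-- A functional uncorrelated with `⟨x, v⟩` is uncorrelated with its sign. -/
lemma integral_iprod_mul_sgn_of_iprod_eq_zero {d : ℕ} {u v : Fin d → ℝ} (h : iprod u v = 0) :
    ∫ x, iprod x u * sgn (iprod x v) ∂(stdGaussianVec d) = 0 := by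
  have hind := (hasGaussianLaw_iprod_prodMk u v).indepFun_of_covariance_eq_zero
    ((covariance_iprod u v).trans h)
  have hprod := (hind.comp measurable_id measurable_sgn).integral_fun_mul_eq_mul_integral
    (hasGaussianLaw_iprod u).aemeasurable.aestronglyMeasurable
    (measurable_sgn.comp_aemeasurable
      (hasGaussianLaw_iprod v).aemeasurable).aestronglyMeasurable
  simpa [Function.comp_def, integral_iprod] using hprod

/-- The expected contribution of one row of the sketching matrix. -/
lemma integral_iprod_mul_sgn {d : ℕ} (q : Fin d → ℝ) {k : Fin d → ℝ} (hk : k ≠ 0) :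
    ∫ x, iprod x q * sgn (iprod x k) ∂(stdGaussianVec d) = iprod q k / nrm k * √(2 / π) := by
  have hn := nrm_pos hk
  set c := iprod q k / nrm k ^ 2 with hc
  have hsub : ∀ x, iprod x (q - c • k) = iprod x q - c * iprod x k := fun x => by
    simp only [iprod, Pi.sub_apply, Pi.smul_apply, smul_eq_mul, Finset.mul_sum,
      ← Finset.sum_sub_distrib]
    exact Finset.sum_congr rfl fun i _ => by ring
  have horth : iprod (q - c • k) k = 0 := by
    have hcomm : ∀ u v : Fin d → ℝ, iprod u v = iprod v u := fun u v => by
      simp [iprod, mul_comm]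
    rw [hcomm, hsub, iprod_self, hcomm, hc]
    field_simp
    ring
  have hdecomp : ∀ x, iprod x q * sgn (iprod x k) =
      iprod x (q - c • k) * sgn (iprod x k) + c * |iprod x k| := fun x => by
    rw [hsub, ← mul_sgn_self]
    ring
  simp_rw [hdecomp]
  rw [integral_add (integrable_iprod_mul_sgn _ _)
      ((hasGaussianLaw_iprod k).integrable.abs.const_mul c),
    integral_iprod_mul_sgn_of_iprod_eq_zero horth, integral_const_mul, integral_abs_iprod hk, hc]
  field_simp
  ring

/-- Unbiasedness of the QJL inner-product estimator:
`E_S[Prod_QJL(q, k)] = ⟨q, k⟩`. -/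
theorem prodQJL_unbiased (m d : ℕ) (hm : 0 < m) (hd : 0 < d)
    (q k : Fin d → ℝ) (hk : k ≠ 0) :
    ∫ S, prodQJL S q k ∂(stdGaussianMat m d) = iprod q k := by
  have hn := nrm_pos hk
  have hm' : (m : ℝ) ≠ 0 := by positivity
  have hint := integrable_iprod_mul_sgn q k
  have hrow : ∀ i : Fin m, ∫ S, iprod (S i) q * sgn (iprod (S i) k) ∂(stdGaussianMat m d) =
      iprod q k / nrm k * √(2 / π) := fun i => by
    rw [← integral_iprod_mul_sgn q hk]
    exact integral_comp_eval (μ := fun _ : Fin m => stdGaussianVec d)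
      hint.aestronglyMeasurable
  have hconst : √(π / 2) * √(2 / π) = 1 := by
    rw [← sqrt_mul (by positivity), div_mul_div_cancel₀ (by norm_num), div_self pi_ne_zero,
      sqrt_one]
  have hintrow : ∀ i : Fin m,
      Integrable (fun S => iprod (S i) q * sgn (iprod (S i) k)) (stdGaussianMat m d) := fun i =>
    integrable_comp_eval (μ := fun _ : Fin m => stdGaussianVec d) (i := i) hint
  unfold prodQJL
  rw [integral_const_mul, integral_finsetSum _ fun i _ => hintrow i]
  simp only [hrow, Finset.sum_const, Finset.card_univ, Fintype.card_fin, nsmul_eq_mul]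
  calc √(π / 2) / m * nrm k * (m * (iprod q k / nrm k * √(2 / π)))
      = (√(π / 2) * √(2 / π)) * iprod q k := by field_simp
    _ = iprod q k := by rw [hconst, one_mul]
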